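/- arXiv:2310.13094 — 2 statements merged into one kernel-verified Lean document; each statement's English description precedes it below -/
import Mathlib

section
/- Let T be a rooted tree in which every vertex other than the root has a unique parent. The shift operator S, defined on finitely supported functions on the vertex set v(T) by (Sf)(v) = f(par(v)) for v different from the root and (Sf)(r) = 0 at the root r, extends to a bounded linear operator on ℓ²(v(T)) if and only if there exists a constant B > 0 such that every vertex u of T has at most B children. -/
open scoped Classical

/-- The shift of a function along the parent map, vanishing at the root. -/
noncomputable def treeShift {V : Type*} (r : V) (par : V → V) (f : V → ℂ) (v : V) : ℂ :=
  if v = r then 0 else f (par v)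

theorem sum_norm_treeShift_rpow_le {V : Type*} {r : V} {par : V → V} {B : ℕ}
    (hB : ∀ u : V, Set.encard {v : V | v ≠ r ∧ par v = u} ≤ (B : ℕ∞))
    {p : ENNReal} (hp : 0 < p.toReal) (f : lp (fun _ : V => ℂ) p) (s : Finset V) :
    ∑ v ∈ s, ‖treeShift r par f v‖ ^ p.toReal ≤ B * ‖f‖ ^ p.toReal := by
  have hs : ∑ v ∈ s, ‖treeShift r par f v‖ ^ p.toReal
      = ∑ v ∈ s with v ≠ r, ‖f (par v)‖ ^ p.toReal := by
    rw [Finset.sum_filter]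
    refine Finset.sum_congr rfl fun v _ => ?_
    by_cases hv : v = r <;> simp [treeShift, hv, Real.zero_rpow hp.ne']
  rw [hs, Finset.sum_comp (fun u => ‖f u‖ ^ p.toReal) par]
  calc _ ≤ ∑ u ∈ (s.filter (· ≠ r)).image par, (B : ℝ) * ‖f u‖ ^ p.toReal := by
        refine Finset.sum_le_sum fun u _ => ?_
        rw [nsmul_eq_mul]
        gcongr
        have hsub : (((s.filter (· ≠ r)).filter (par · = u) : Finset V) : Set V)
            ⊆ {v : V | v ≠ r ∧ par v = u} := by
          intro v hv
          simp only [Finset.coe_filter, Finset.mem_filter, Set.mem_ofPred_eq] at hv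
          exact ⟨hv.1.2, hv.2⟩
        have hle := (Set.encard_le_encard hsub).trans (hB u)
        rw [Set.encard_coe_eq_coe_finsetCard] at hle
        exact_mod_cast hle
    _ ≤ B * ‖f‖ ^ p.toReal := by
        rw [← Finset.mul_sum]
        gcongr
        exact lp.sum_rpow_le_norm_rpow hp f _

theorem exists_continuousLinearMap_treeShift {V : Type*} {r : V} {par : V → V} {B : ℕ}
    (hB : ∀ u : V, Set.encard {v : V | v ≠ r ∧ par v = u} ≤ (B : ℕ∞)) :
    ∃ S : lp (fun _ : V => ℂ) 2 →L[ℂ] lp (fun _ : V => ℂ) 2,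
      ∀ (f : lp (fun _ : V => ℂ) 2) (v : V), S f v = treeShift r par f v := by
  have h2 : 0 < (2 : ENNReal).toReal := by norm_num
  let L : lp (fun _ : V => ℂ) 2 →ₗ[ℂ] lp (fun _ : V => ℂ) 2 :=
    { toFun := fun f => ⟨treeShift r par f, memℓp_gen' (sum_norm_treeShift_rpow_le hB h2 f)⟩
      map_add' := fun f g => by
        ext v
        change treeShift r par (f + g : lp (fun _ : V => ℂ) 2) v
          = treeShift r par f v + treeShift r par g v
        by_cases hv : v = r <;> simp [treeShift, hv]
      map_smul' := fun c f => by
        ext v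
        by_cases hv : v = r <;> simp [treeShift, hv] }
  refine ⟨L.mkContinuous (√B) fun f => ?_, fun f v => rfl⟩
  refine lp.norm_le_of_forall_sum_le h2 (by positivity) fun s => ?_
  refine (sum_norm_treeShift_rpow_le hB h2 f s).trans_eq ?_
  simp [mul_pow]

theorem encard_children_le_of_treeShift {V : Type*} {r : V} {par : V → V}
    (S : lp (fun _ : V => ℂ) 2 →L[ℂ] lp (fun _ : V => ℂ) 2)
    (hS : ∀ (f : lp (fun _ : V => ℂ) 2) (v : V), S f v = treeShift r par f v) (u : V) :
    Set.encard {v : V | v ≠ r ∧ par v = u} ≤ (⌊‖S‖ ^ 2⌋₊ : ℕ∞) := by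
  have h2 : 0 < (2 : ENNReal).toReal := by norm_num
  by_contra! hlt
  obtain ⟨t, ht, htc⟩ := Set.exists_subset_encard_eq (Order.add_one_le_of_lt hlt)
  have hfin : t.Finite := Set.finite_of_encard_eq_coe (k := ⌊‖S‖ ^ 2⌋₊ + 1) (by exact_mod_cast htc)
  lift t to Finset V using hfin
  rw [Set.encard_coe_eq_coe_finsetCard] at htc
  have hcard : t.card = ⌊‖S‖ ^ 2⌋₊ + 1 := by exact_mod_cast htc
  let f : lp (fun _ : V => ℂ) 2 := lp.single 2 u 1
  have hf : ‖f‖ = 1 := by simp [f, lp.norm_single]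
  have hsum := lp.sum_rpow_le_norm_rpow h2 (S f) t
  have hone : ∀ v ∈ t, ‖S f v‖ ^ (2 : ENNReal).toReal = 1 := by
    intro v hv
    obtain ⟨hvr, hvu⟩ := ht hv
    simp [hS, treeShift, hvr, hvu, f]
  rw [Finset.sum_congr rfl hone] at hsum
  simp only [Finset.sum_const, nsmul_eq_mul, mul_one, ENNReal.toReal_ofNat, Real.rpow_ofNat] at hsum
  have hSf : ‖S f‖ ≤ ‖S‖ := by simpa [hf] using S.le_opNorm f
  have hle : (t.card : ℝ) ≤ ‖S‖ ^ 2 := hsum.trans (by gcongr)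
  have := Nat.le_floor hle
  omega

/-- **Boundedness of the shift operator on a rooted tree** (Ward, Thm. 1.20).

`V` is the vertex set of a rooted tree with root `r`; every vertex `v ≠ r` has the
(unique) parent `par v`, and every vertex is connected to the root by iterating `par`.
The shift `(Sf)(v) = f(par v)` for `v ≠ r`, `(Sf)(r) = 0`, defined on finitely supported
functions, extends to a bounded linear operator on `ℓ²(V)` if and only if there is a
constant `B > 0` bounding the number of children of every vertex. -/
theorem shift_operator_bounded_iff_children_bounded
    (V : Type*) (r : V) (par : V → V)
    (htree : ∀ v : V, v ≠ r → ∃ n : ℕ, par^[n] v = r) :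
    (∃ S : lp (fun _ : V => ℂ) 2 →L[ℂ] lp (fun _ : V => ℂ) 2,
        ∀ (f : lp (fun _ : V => ℂ) 2) (v : V),
          S f v = if v = r then 0 else f (par v)) ↔
      (∃ B : ℕ, 0 < B ∧ ∀ u : V,
          Set.encard {v : V | v ≠ r ∧ par v = u} ≤ (B : ℕ∞)) := by
  constructor
  · rintro ⟨S, hS⟩
    exact ⟨⌊‖S‖ ^ 2⌋₊ + 1, Nat.succ_pos _, fun u =>
      (encard_children_le_of_treeShift S hS u).trans (by exact_mod_cast Nat.le_succ _)⟩
  · rintro ⟨B, -, hB⟩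
    exact exists_continuousLinearMap_treeShift hB
end

section
/- There exists an isometric star-algebra isomorphism φ from the smallest closed star-subalgebra of the bounded operators on ℓ²(v(T)) containing the isometry L = (1/√2)·S onto the smallest closed star-subalgebra of the bounded operators on ℓ²(ℕ) containing the unilateral shift V, such that φ(L) = V. -/
open scoped Classical

set_option synthInstance.maxHeartbeats 1000000
set_option maxHeartbeats 1000000

noncomputable section

open scoped InnerProductSpace

section Isometry

variable {H K : Type*} [NormedAddCommGroup H] [InnerProductSpace ℂ H] [CompleteSpace H]
  [NormedAddCommGroup K] [InnerProductSpace ℂ K] [CompleteSpace K]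

theorem star_apply_apply_of_star_mul_self {L : H →L[ℂ] H} (hL : star L * L = 1) (f : H) :
    star L (L f) = f :=
  congrArg (fun A : H →L[ℂ] H => A f) hL

theorem inner_map_map_of_star_mul_self {L : H →L[ℂ] H} (hL : star L * L = 1) (f g : H) :
    ⟪L f, L g⟫_ℂ = ⟪f, g⟫_ℂ := by
  rw [← ContinuousLinearMap.adjoint_inner_left, ← ContinuousLinearMap.star_eq_adjoint,
    star_apply_apply_of_star_mul_self hL]

theorem orthonormal_pow_apply {L : H →L[ℂ] H} (hL : star L * L = 1) {w : H}
    (hw : star L w = 0) (hw1 : ‖w‖ = 1) : Orthonormal ℂ fun n : ℕ => (L ^ n) w := by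
  have key : ∀ m n : ℕ, ⟪(L ^ m) w, (L ^ n) w⟫_ℂ = if m = n then 1 else 0 := by
    intro m
    induction m with
    | zero =>
      rintro (_ | n)
      · simp [inner_self_eq_norm_sq_to_K, hw1]
      · rw [pow_succ', pow_zero, one_apply_eq_self,
          mul_apply_eq_comp,
          ← ContinuousLinearMap.adjoint_inner_left, ← ContinuousLinearMap.star_eq_adjoint, hw]
        simp
    | succ m ih =>
      rintro (_ | n)
      · rw [pow_succ', pow_zero, one_apply_eq_self,
          mul_apply_eq_comp,
          ← ContinuousLinearMap.adjoint_inner_right, ← ContinuousLinearMap.star_eq_adjoint, hw]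
        simp
      · rw [pow_succ', pow_succ', mul_apply_eq_comp, mul_apply_eq_comp,
          inner_map_map_of_star_mul_self hL, ih]
        simp
  exact orthonormal_iff_ite.mpr key

/-- If the powers of an isometry `L` have no common nonzero range vector, then the vectors `L ^ n w`
with `w ∈ ker L*` have trivial orthogonal complement. -/
theorem eq_zero_of_inner_pow_apply_eq_zero {L : H →L[ℂ] H} (hL : star L * L = 1)
    (hpure : ∀ f : H, (∀ n : ℕ, ∃ g, f = (L ^ n) g) → f = 0) {f : H}
    (hf : ∀ (n : ℕ) (w : H), star L w = 0 → ⟪(L ^ n) w, f⟫_ℂ = 0) : f = 0 := by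
  have hker : ∀ g : H, (∀ w, star L w = 0 → ⟪w, g⟫_ℂ = 0) → g = L (star L g) := by
    intro g hg
    have hw : star L (g - L (star L g)) = 0 := by
      rw [map_sub, star_apply_apply_of_star_mul_self hL, sub_self]
    have h1 := hg _ hw
    have h2 : ⟪g - L (star L g), L (star L g)⟫_ℂ = 0 := by
      rw [← ContinuousLinearMap.adjoint_inner_left, ← ContinuousLinearMap.star_eq_adjoint, hw,
        inner_zero_left]
    have h3 : ⟪g - L (star L g), g - L (star L g)⟫_ℂ = 0 := by
      rw [inner_sub_right, h1, h2, sub_zero]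
    exact sub_eq_zero.mp (inner_self_eq_zero.mp h3)
  have key : ∀ n : ℕ, ∃ g, f = (L ^ n) g := by
    intro n
    induction n with
    | zero => exact ⟨f, by simp⟩
    | succ n ih =>
      obtain ⟨g, rfl⟩ := ih
      have hinner : ∀ (n : ℕ) (a b : H), ⟪(L ^ n) a, (L ^ n) b⟫_ℂ = ⟪a, b⟫_ℂ := by
        intro n
        induction n with
        | zero => simp
        | succ n ihn =>
          intro a b
          rw [pow_succ', mul_apply_eq_comp, mul_apply_eq_comp,
            inner_map_map_of_star_mul_self hL, ihn]
      have hg := hker g fun w hw => by rw [← hinner n]; exact hf n w hw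
      refine ⟨star L g, ?_⟩
      rw [pow_succ, mul_apply_eq_comp, ← hg]
  exact hpure f key

theorem star_apply_single_of_map_single {V : lp (fun _ : ℕ => ℂ) 2 →L[ℂ] lp (fun _ : ℕ => ℂ) 2}
    (hV : ∀ n : ℕ, V (lp.single 2 n (1 : ℂ)) = lp.single 2 (n + 1) (1 : ℂ)) :
    (∀ n : ℕ, star V (lp.single 2 (n + 1) (1 : ℂ)) = lp.single 2 n (1 : ℂ)) ∧
      star V (lp.single 2 0 (1 : ℂ)) = 0 := by
  have coord : ∀ (g : lp (fun _ : ℕ => ℂ) 2) (m : ℕ), (star V g) m = g (m + 1) := by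
    intro g m
    have h : ⟪(lp.single 2 m (1 : ℂ) : lp (fun _ : ℕ => ℂ) 2), star V g⟫_ℂ = g (m + 1) := by
      rw [ContinuousLinearMap.star_eq_adjoint, ContinuousLinearMap.adjoint_inner_right, hV,
        lp.inner_single_left]
      simp
    rw [lp.inner_single_left] at h
    simpa using h
  constructor
  · intro n
    ext m
    rw [coord, lp.single_apply, lp.single_apply]
    by_cases h : m = n <;> simp [h]
  · ext m
    rw [coord, lp.single_apply]
    simp

/-- A unit vector in `ker L*` generates a copy of the unilateral shift `V` reducing `L`. -/
theorem exists_intertwining_isometry {L : H →L[ℂ] H} (hL : star L * L = 1)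
    {V : lp (fun _ : ℕ => ℂ) 2 →L[ℂ] lp (fun _ : ℕ => ℂ) 2}
    (hV : ∀ n : ℕ, V (lp.single 2 n (1 : ℂ)) = lp.single 2 (n + 1) (1 : ℂ)) {w : H}
    (hw : star L w = 0) (hw1 : ‖w‖ = 1) :
    ∃ U : lp (fun _ : ℕ => ℂ) 2 →L[ℂ] H,
      (∀ v, U.adjoint (U v) = v) ∧ (∀ n : ℕ, U (lp.single 2 n (1 : ℂ)) = (L ^ n) w) ∧
        (∀ v, L (U v) = U (V v)) ∧ ∀ v, star L (U v) = U (star V v) := by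
  obtain ⟨hV1, hV0⟩ := star_apply_single_of_map_single hV
  have ho := (orthonormal_pow_apply hL hw hw1).orthogonalFamily
  let U : lp (fun _ : ℕ => ℂ) 2 →L[ℂ] H := ho.linearIsometry.toContinuousLinearMap
  have hU : ∀ n : ℕ, U (lp.single 2 n (1 : ℂ)) = (L ^ n) w := fun n =>
    (ho.linearIsometry_apply_single (1 : ℂ)).trans (by simp)
  have hext : ∀ A B : lp (fun _ : ℕ => ℂ) 2 →L[ℂ] H,
      (∀ n, A (lp.single 2 n (1 : ℂ)) = B (lp.single 2 n (1 : ℂ))) → ∀ v, A v = B v := by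
    intro A B h v
    have : A = B := by
      refine lp.ext_continuousLinearMap (by simp) fun n => ?_
      ext
      simpa using h n
    rw [this]
  refine ⟨U, ?_, hU, hext (L ∘L U) (U ∘L V) ?_, hext (star L ∘L U) (U ∘L star V) ?_⟩
  · have h := U.norm_map_iff_adjoint_comp_self.mp ho.linearIsometry.norm_map
    exact fun v => congrArg (fun A : _ →L[ℂ] _ => A v) h
  · intro n
    rw [ContinuousLinearMap.comp_apply, ContinuousLinearMap.comp_apply, hV, hU, hU, pow_succ']
    rfl
  · rintro (_ | n)
    · simp [hU, hV0, hw]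
    · rw [ContinuousLinearMap.comp_apply, ContinuousLinearMap.comp_apply, hV1, hU, hU, pow_succ',
        mul_apply_eq_comp, star_apply_apply_of_star_mul_self hL]

/-- Compressing by `U₀` carries the elements of `C*(L)` to the operators that `U` intertwines
with them. -/
theorem apply_eq_of_mem_elemental {L : H →L[ℂ] H} {V : K →L[ℂ] K} {U₀ U : K →L[ℂ] H}
    (hU₀ : ∀ v, U₀.adjoint (U₀ v) = v)
    (hL₀ : ∀ v, L (U₀ v) = U₀ (V v)) (hLs₀ : ∀ v, star L (U₀ v) = U₀ (star V v))
    (hL : ∀ v, L (U v) = U (V v)) (hLs : ∀ v, star L (U v) = U (star V v))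
    {x : H →L[ℂ] H} (hx : x ∈ StarAlgebra.elemental ℂ L) :
    (∀ v, x (U v) = U (U₀.adjoint (x (U₀ v)))) ∧ ∀ v, x (U₀ v) = U₀ (U₀.adjoint (x (U₀ v))) := by
  induction hx using StarAlgebra.elemental.induction_on with
  | self => exact ⟨fun v => by rw [hL, hL₀, hU₀], fun v => by rw [hL₀, hU₀]⟩
  | star_self => exact ⟨fun v => by rw [hLs, hLs₀, hU₀], fun v => by rw [hLs₀, hU₀]⟩
  | algebraMap r =>
    simp only [Algebra.algebraMap_eq_smul_one, smul_apply,
      one_apply_eq_self, map_smul, hU₀, implies_true,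
      and_self]
  | add a ha b hb iha ihb =>
    simp only [add_apply, map_add]
    exact ⟨fun v => by rw [← iha.1, ← ihb.1], fun v => by rw [← iha.2, ← ihb.2]⟩
  | mul a ha b hb iha ihb =>
    simp only [mul_apply_eq_comp]
    exact ⟨fun v => by rw [ihb.1, iha.1, ← ihb.2], fun v => by rw [ihb.2, ← iha.2]⟩
  | closure s hs ih x hx =>
    have hclosed : IsClosed {x : H →L[ℂ] H | (∀ v, x (U v) = U (U₀.adjoint (x (U₀ v)))) ∧
        ∀ v, x (U₀ v) = U₀ (U₀.adjoint (x (U₀ v)))} := by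
      simp only [Set.ofPred_and, Set.ofPred_forall]
      exact (isClosed_iInter fun v => isClosed_eq (by fun_prop) (by fun_prop)).inter
        (isClosed_iInter fun v => isClosed_eq (by fun_prop) (by fun_prop))
    exact closure_minimal (fun u hu => ih u hu) hclosed hx

theorem compression_mem_elemental {L : H →L[ℂ] H} {V : K →L[ℂ] K} {U : K →L[ℂ] H}
    (hU : ∀ v, U.adjoint (U v) = v)
    (hL : ∀ v, L (U v) = U (V v)) (hLs : ∀ v, star L (U v) = U (star V v))
    {x : H →L[ℂ] H} (hx : x ∈ StarAlgebra.elemental ℂ L) :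
    U.adjoint ∘L x ∘L U ∈ StarAlgebra.elemental ℂ V := by
  induction hx using StarAlgebra.elemental.induction_on with
  | self =>
    convert StarAlgebra.elemental.self_mem ℂ V
    ext1 v
    simp [hL, hU]
  | star_self =>
    convert StarAlgebra.elemental.star_self_mem ℂ V
    ext1 v
    simp only [ContinuousLinearMap.comp_apply, hLs, hU]
  | algebraMap r =>
    convert algebraMap_mem (StarAlgebra.elemental ℂ V) r
    ext1 v
    simp [Algebra.algebraMap_eq_smul_one, hU]
  | add a ha b hb iha ihb =>
    convert add_mem iha ihb
    ext1 v
    simp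
  | mul a ha b hb iha ihb =>
    convert mul_mem iha ihb
    ext1 v
    simp only [ContinuousLinearMap.comp_apply, mul_apply_eq_comp]
    rw [← (apply_eq_of_mem_elemental hU hL hLs hL hLs hb).2]
  | closure s hs ih x hx =>
    have hcont : Continuous fun x : H →L[ℂ] H => U.adjoint ∘L x ∘L U :=
      continuous_const.clm_comp (continuous_id.clm_comp continuous_const)
    exact closure_minimal (fun u hu => ih u hu)
      ((StarAlgebra.elemental.isClosed ℂ V).preimage hcont) hx

/-- Compression by an isometry intertwining `V` with `L`, as a homomorphism `C*(L) → C*(V)`. -/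
def elementalCompression {L : H →L[ℂ] H} {V : K →L[ℂ] K} (U : K →L[ℂ] H)
    (hU : ∀ v, U.adjoint (U v) = v)
    (hL : ∀ v, L (U v) = U (V v)) (hLs : ∀ v, star L (U v) = U (star V v)) :
    StarAlgebra.elemental ℂ L →⋆ₐ[ℂ] StarAlgebra.elemental ℂ V where
  toFun x := ⟨U.adjoint ∘L (x : H →L[ℂ] H) ∘L U, compression_mem_elemental hU hL hLs x.2⟩
  map_one' := by
    ext1
    ext1 v
    simp [hU]
  map_mul' a b := by
    ext1
    ext1 v
    simp only [ContinuousLinearMap.comp_apply, mul_apply_eq_comp,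
      MulMemClass.coe_mul]
    rw [← (apply_eq_of_mem_elemental hU hL hLs hL hLs b.2).2]
  map_zero' := by
    ext1
    ext1 v
    simp
  map_add' a b := by
    ext1
    ext1 v
    simp
  commutes' r := by
    ext1
    ext1 v
    simp [Algebra.algebraMap_eq_smul_one, hU]
  map_star' a := by
    ext1
    simp [ContinuousLinearMap.star_eq_adjoint, ContinuousLinearMap.adjoint_comp,
      ContinuousLinearMap.comp_assoc]

/-- **Coburn's theorem** for a pure isometry `L` that is not unitary. -/
theorem exists_elemental_starAlgEquiv_of_pure_isometry {L : H →L[ℂ] H} (hL : star L * L = 1)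
    (hpure : ∀ f : H, (∀ n : ℕ, ∃ g, f = (L ^ n) g) → f = 0)
    {w₀ : H} (hw₀ : star L w₀ = 0) (hw₀1 : ‖w₀‖ = 1)
    {V : lp (fun _ : ℕ => ℂ) 2 →L[ℂ] lp (fun _ : ℕ => ℂ) 2}
    (hV : ∀ n : ℕ, V (lp.single 2 n (1 : ℂ)) = lp.single 2 (n + 1) (1 : ℂ)) :
    ∃ φ : StarAlgebra.elemental ℂ L ≃⋆ₐ[ℂ] StarAlgebra.elemental ℂ V,
      (∀ x : StarAlgebra.elemental ℂ L, ‖φ x‖ = ‖x‖) ∧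
        φ ⟨L, StarAlgebra.elemental.self_mem ℂ L⟩
          = ⟨V, StarAlgebra.elemental.self_mem ℂ V⟩ := by
  obtain ⟨U, hU, -, hLU, hLsU⟩ := exists_intertwining_isometry hL hV hw₀ hw₀1
  let ψ := elementalCompression U hU hLU hLsU
  have hψL : ψ ⟨L, StarAlgebra.elemental.self_mem ℂ L⟩
      = ⟨V, StarAlgebra.elemental.self_mem ℂ V⟩ := by
    ext1
    ext1 v
    change U.adjoint (L (U v)) = V v
    rw [hLU, hU]
  have hinj : Function.Injective ψ := by
    refine (injective_iff_map_eq_zero ψ).mpr fun x hx => ?_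
    have hx0 : ∀ v, U.adjoint ((x : H →L[ℂ] H) (U v)) = 0 := fun v =>
      congrArg (fun A : StarAlgebra.elemental ℂ V =>
        (A : lp (fun _ : ℕ => ℂ) 2 →L[ℂ] lp (fun _ : ℕ => ℂ) 2) v) hx
    have hunit : ∀ (n : ℕ) (w : H), star L w = 0 → ‖w‖ = 1 →
        (x : H →L[ℂ] H) ((L ^ n) w) = 0 := by
      intro n w hw hw1
      obtain ⟨W, -, hWn, hLW, hLsW⟩ := exists_intertwining_isometry hL hV hw hw1
      rw [← hWn, (apply_eq_of_mem_elemental hU hLU hLsU hLW hLsW x.2).1, hx0, map_zero]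
    have hall : ∀ (n : ℕ) (w : H), star L w = 0 → (x : H →L[ℂ] H) ((L ^ n) w) = 0 := by
      intro n w hw
      by_cases h0 : w = 0
      · simp [h0]
      · have hn : (‖w‖ : ℂ) ≠ 0 := by simpa using h0
        have := hunit n ((‖w‖ : ℂ)⁻¹ • w) (by rw [map_smul, hw, smul_zero])
          (by simp [norm_smul, h0])
        rw [map_smul, map_smul] at this
        exact (smul_eq_zero.mp this).resolve_left (inv_ne_zero hn)
    ext1
    ext1 f
    refine ext_inner_left ℂ fun g => ?_
    have hz : (x : H →L[ℂ] H).adjoint g = 0 := by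
      refine eq_zero_of_inner_pow_apply_eq_zero hL hpure fun n w hw => ?_
      rw [ContinuousLinearMap.adjoint_inner_right, hall n w hw, inner_zero_left]
    rw [← ContinuousLinearMap.adjoint_inner_left, hz]
    simp
  have hnorm : ∀ x, ‖ψ x‖ = ‖x‖ := NonUnitalStarAlgHom.norm_map ψ hinj
  have hsurj : Function.Surjective ψ := by
    let ρ := (StarAlgebra.elemental ℂ V).subtype.comp ψ
    have hρ : Isometry ρ := AddMonoidHomClass.isometry_of_norm ρ hnorm
    have hclosed : IsClosed (ρ.range : Set (lp (fun _ : ℕ => ℂ) 2 →L[ℂ] lp (fun _ : ℕ => ℂ) 2)) :=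
      hρ.isClosedEmbedding.isClosed_range
    have hle : StarAlgebra.elemental ℂ V ≤ ρ.range :=
      StarAlgebra.elemental.le_of_mem hclosed ⟨_, congrArg Subtype.val hψL⟩
    intro y
    obtain ⟨x, hx⟩ := hle y.2
    exact ⟨x, Subtype.ext hx⟩
  exact ⟨StarAlgEquiv.ofBijective ψ ⟨hinj, hsurj⟩, hnorm, hψL⟩

end Isometry

section Tree

theorem hasSum_norm_sq_lp_two {ι : Type*} (f : lp (fun _ : ι => ℂ) 2) :
    HasSum (fun i => ‖f i‖ ^ 2) (‖f‖ ^ 2) := by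
  have h := lp.hasSum_norm (p := 2) (by norm_num) f
  simpa using h

/-- Every word other than the root is the child of exactly one word. -/
theorem norm_sq_treeShift {S : lp (fun _ : List Bool => ℂ) 2 →L[ℂ] lp (fun _ : List Bool => ℂ) 2}
    (hS : ∀ (f : lp (fun _ : List Bool => ℂ) 2) (v : List Bool),
      S f v = if v = [] then 0 else f v.dropLast) (f : lp (fun _ : List Bool => ℂ) 2) :
    ‖S f‖ ^ 2 = 2 * ‖f‖ ^ 2 := by
  let e : List Bool × Bool → List Bool := fun p => p.1 ++ [p.2]
  have he : Function.Injective e := by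
    rintro ⟨a, b⟩ ⟨c, d⟩ h
    simpa [e] using h
  have hf := hasSum_norm_sq_lp_two f
  have hb : HasSum (fun _ : Bool => (1 : ℝ)) 2 := by
    simpa using hasSum_fintype fun _ : Bool => (1 : ℝ)
  have hprod : HasSum (fun p : List Bool × Bool => ‖f p.1‖ ^ 2 * 1) (‖f‖ ^ 2 * 2) :=
    hf.mul hb (hf.summable.mul_of_nonneg hb.summable (fun _ => sq_nonneg _) fun _ => zero_le_one)
  have hcomp : HasSum ((fun v => ‖S f v‖ ^ 2) ∘ e) (‖f‖ ^ 2 * 2) := by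
    convert hprod using 2 with p
    simp [e, hS]
  have hSf : HasSum (fun v => ‖S f v‖ ^ 2) (‖f‖ ^ 2 * 2) := by
    refine (he.hasSum_iff fun v hv => ?_).mp hcomp
    rcases List.eq_nil_or_concat v with rfl | ⟨u, b, rfl⟩
    · simp [hS]
    · exact absurd ⟨(u, b), by simp [e]⟩ hv
  rw [(hasSum_norm_sq_lp_two (S f)).unique hSf, mul_comm]

end Tree

/-- **`C*(L) ≅ C*(V)`: the C*-algebra generated by the rescaled shift on the binary
tree is isomorphic to the C*-algebra generated by the unilateral shift.**

`S` is the shift operator on `ℓ²` of the binary tree (vertices = finite words over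
`{0,1}`, root = empty word, parent = delete the last letter), `L = (1/√2)·S` is an
isometry, and `V` is the unilateral shift on `ℓ²(ℕ)`, `V e_n = e_{n+1}`.  There is an
isometric star-algebra isomorphism `φ` from the smallest closed star-subalgebra of
`B(ℓ²(v(T)))` containing `L` onto the smallest closed star-subalgebra of `B(ℓ²(ℕ))`
containing `V`, with `φ(L) = V`. -/
theorem elemental_algebra_of_L_iso_elemental_algebra_of_shift
    (S : lp (fun _ : List Bool => ℂ) 2 →L[ℂ] lp (fun _ : List Bool => ℂ) 2)
    (hS : ∀ (f : lp (fun _ : List Bool => ℂ) 2) (v : List Bool),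
      S f v = if v = [] then 0 else f v.dropLast)
    (L : lp (fun _ : List Bool => ℂ) 2 →L[ℂ] lp (fun _ : List Bool => ℂ) 2)
    (hL : L = ((Real.sqrt 2 : ℂ))⁻¹ • S)
    (V : lp (fun _ : ℕ => ℂ) 2 →L[ℂ] lp (fun _ : ℕ => ℂ) 2)
    (hV : ∀ n : ℕ, V (lp.single 2 n (1 : ℂ)) = lp.single 2 (n + 1) (1 : ℂ)) :
    ∃ φ : StarAlgebra.elemental ℂ L ≃⋆ₐ[ℂ] StarAlgebra.elemental ℂ V,
      (∀ x : StarAlgebra.elemental ℂ L, ‖φ x‖ = ‖x‖) ∧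
        φ ⟨L, StarAlgebra.elemental.self_mem ℂ L⟩
          = ⟨V, StarAlgebra.elemental.self_mem ℂ V⟩ := by
  have hc : (Real.sqrt 2 : ℂ) ≠ 0 := by simp
  have hLv : ∀ (f : lp (fun _ : List Bool => ℂ) 2) (v : List Bool),
      L f v = (Real.sqrt 2 : ℂ)⁻¹ * if v = [] then 0 else f v.dropLast := by
    intro f v
    rw [← hS, hL]
    rfl
  have hiso : star L * L = 1 := by
    refine L.norm_map_iff_adjoint_comp_self.mp fun f => ?_
    have h2 : ‖L f‖ ^ 2 = ‖f‖ ^ 2 := by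
      rw [hL, smul_apply, norm_smul, mul_pow, norm_sq_treeShift hS]
      simp
    exact (sq_eq_sq₀ (norm_nonneg _) (norm_nonneg _)).mp h2
  have hpow : ∀ (n : ℕ) (g : lp (fun _ : List Bool => ℂ) 2) (v : List Bool), v.length < n →
      (L ^ n) g v = 0 := by
    intro n
    induction n with
    | zero => simp
    | succ n ih =>
      intro g v hv
      rw [pow_succ', mul_apply_eq_comp, hLv]
      split_ifs with h
      · simp
      · rw [ih, mul_zero]
        have := List.length_pos_iff.mpr h
        rw [List.length_dropLast]
        omega
  refine exists_elemental_starAlgEquiv_of_pure_isometry hiso (fun f hf => ?_)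
    (w₀ := lp.single 2 [] (1 : ℂ)) ?_ ?_ hV
  · ext v
    obtain ⟨g, rfl⟩ := hf (v.length + 1)
    exact hpow _ g v (Nat.lt_succ_self _)
  · refine ext_inner_left ℂ fun g => ?_
    rw [ContinuousLinearMap.star_eq_adjoint, ContinuousLinearMap.adjoint_inner_right,
      lp.inner_single_right, hLv]
    simp
  · rw [lp.norm_single (by norm_num)]
    simp
end
end
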